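/- (IHT error bound, precise form of the Inner Hadamard case of the Row-Column error theorem.) Let A be a nonzero real m×k matrix, B a nonzero real k×n matrix, H a real k×k matrix with Hᵀ * H = I, and ε ≥ 0. Let Q_A be a real m×k matrix with ‖Q_A − A*H‖_F ≤ ε·√(γ(A*H))·‖A‖_F and Q_B a real k×n matrix with ‖Q_B − Hᵀ*B‖_F ≤ ε·√(γ(Hᵀ*B))·‖B‖_F, where A*H and Hᵀ*B are nonzero. Then ‖A·B − Q_A·Q_B‖_F ≤ ε·(√(γ(A*H)) + √(γ(Hᵀ*B)) + ε·√(γ(A*H)·γ(Hᵀ*B))) · ‖A‖_F · ‖B‖_F. -/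

import Mathlib

open Matrix BigOperators

/-- The Frobenius norm of a real matrix: `‖M‖_F = sqrt (∑ i j, (M i j)^2)`. -/
noncomputable def frob {m n : ℕ} (M : Matrix (Fin m) (Fin n) ℝ) : ℝ :=
  Real.sqrt (∑ i, ∑ j, (M i j) ^ 2)

/-- The maximum absolute value of an entry of a real matrix. -/
noncomputable def maxAbs {m n : ℕ} (M : Matrix (Fin m) (Fin n) ℝ) : ℝ :=
  ⨆ i, ⨆ j, |M i j|

/-- The outlier factor `γ(M) = m·n·(max_{i,j} |M_{ij}|)² / ‖M‖_F²` of a real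
`m × n` matrix, measuring how concentrated its energy is in extreme values. -/
noncomputable def outlierFactor {m n : ℕ} (M : Matrix (Fin m) (Fin n) ℝ) : ℝ :=
  (m * n : ℝ) * (maxAbs M) ^ 2 / (frob M) ^ 2

section frobenius

attribute [local instance] Matrix.frobeniusNormedAddCommGroup

theorem frob_eq_norm {m n : ℕ} (M : Matrix (Fin m) (Fin n) ℝ) : frob M = ‖M‖ := by
  simp [frob, Matrix.frobenius_norm_def, Real.sqrt_eq_rpow]

theorem frob_mul_le {l m n : ℕ} (M : Matrix (Fin l) (Fin m) ℝ) (N : Matrix (Fin m) (Fin n) ℝ) :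
    frob (M * N) ≤ frob M * frob N := by
  simpa only [frob_eq_norm] using Matrix.frobenius_norm_mul M N

theorem frob_add_le {m n : ℕ} (M N : Matrix (Fin m) (Fin n) ℝ) :
    frob (M + N) ≤ frob M + frob N := by
  simpa only [frob_eq_norm] using norm_add_le M N

theorem frob_neg {m n : ℕ} (M : Matrix (Fin m) (Fin n) ℝ) : frob (-M) = frob M := by
  simp [frob]

theorem frob_transpose {m n : ℕ} (M : Matrix (Fin m) (Fin n) ℝ) : frob Mᵀ = frob M := by
  simpa only [frob_eq_norm] using Matrix.frobenius_norm_transpose M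

end frobenius

theorem frob_nonneg {m n : ℕ} (M : Matrix (Fin m) (Fin n) ℝ) : 0 ≤ frob M :=
  Real.sqrt_nonneg _

theorem frob_eq_sqrt_trace {m n : ℕ} (M : Matrix (Fin m) (Fin n) ℝ) :
    frob M = Real.sqrt (M * Mᵀ).trace := by
  simp [frob, Matrix.trace, Matrix.mul_apply, sq]

theorem frob_mul_of_mul_transpose_eq_one {m k : ℕ} (M : Matrix (Fin m) (Fin k) ℝ)
    {H : Matrix (Fin k) (Fin k) ℝ} (hH : H * Hᵀ = 1) : frob (M * H) = frob M := by
  rw [frob_eq_sqrt_trace, frob_eq_sqrt_trace, Matrix.transpose_mul, Matrix.mul_assoc,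
    ← Matrix.mul_assoc H, hH, Matrix.one_mul]

theorem outlierFactor_nonneg {m n : ℕ} (M : Matrix (Fin m) (Fin n) ℝ) : 0 ≤ outlierFactor M := by
  unfold outlierFactor
  positivity

/-- Perturbing both factors of a product by relative errors `a` and `b` perturbs the product by a
relative error of at most `a + b + a * b`. -/
theorem frob_mul_sub_mul_le {l m n : ℕ} (X X' : Matrix (Fin l) (Fin m) ℝ)
    (Y Y' : Matrix (Fin m) (Fin n) ℝ) {a b : ℝ} (hX : frob (X' - X) ≤ a * frob X)
    (hY : frob (Y' - Y) ≤ b * frob Y) :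
    frob (X * Y - X' * Y') ≤ (a + b + a * b) * frob X * frob Y := by
  have hdecomp : X * Y - X' * Y' =
      -((X' - X) * Y + X * (Y' - Y) + (X' - X) * (Y' - Y)) := by
    simp only [Matrix.sub_mul, Matrix.mul_sub]
    abel
  have hXY : frob ((X' - X) * Y) ≤ a * frob X * frob Y :=
    (frob_mul_le _ _).trans (mul_le_mul_of_nonneg_right hX (frob_nonneg _))
  have hYX : frob (X * (Y' - Y)) ≤ frob X * (b * frob Y) :=
    (frob_mul_le _ _).trans (mul_le_mul_of_nonneg_left hY (frob_nonneg _))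
  have hXX : frob ((X' - X) * (Y' - Y)) ≤ a * frob X * (b * frob Y) :=
    (frob_mul_le _ _).trans
      (mul_le_mul hX hY (frob_nonneg _) ((frob_nonneg _).trans hX))
  rw [hdecomp, frob_neg]
  linarith [frob_add_le ((X' - X) * Y + X * (Y' - Y)) ((X' - X) * (Y' - Y)),
    frob_add_le ((X' - X) * Y) (X * (Y' - Y))]

/-- IHT error bound (Inner Hadamard case of the Row-Column error
theorem). With orthogonal `H` and quantized operands `Q_A ≈ A*H`,
`Q_B ≈ Hᵀ*B` whose Frobenius errors are bounded by `ε·√γ` times the operand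
norms, the product error satisfies
`‖A·B − Q_A·Q_B‖_F ≤ ε·(√γ(AH) + √γ(HᵀB) + ε·√(γ(AH)·γ(HᵀB)))·‖A‖_F·‖B‖_F`. -/
theorem iht_error_bound {m k n : ℕ}
    (A : Matrix (Fin m) (Fin k) ℝ) (hA : A ≠ 0)
    (B : Matrix (Fin k) (Fin n) ℝ) (hB : B ≠ 0)
    (H : Matrix (Fin k) (Fin k) ℝ) (hH : Hᵀ * H = 1)
    (ε : ℝ) (hε : 0 ≤ ε)
    (hAH : A * H ≠ 0) (hHB : Hᵀ * B ≠ 0)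
    (QA : Matrix (Fin m) (Fin k) ℝ)
    (hQA : frob (QA - A * H) ≤ ε * Real.sqrt (outlierFactor (A * H)) * frob A)
    (QB : Matrix (Fin k) (Fin n) ℝ)
    (hQB : frob (QB - Hᵀ * B) ≤ ε * Real.sqrt (outlierFactor (Hᵀ * B)) * frob B) :
    frob (A * B - QA * QB) ≤
      ε * (Real.sqrt (outlierFactor (A * H)) + Real.sqrt (outlierFactor (Hᵀ * B)) +
          ε * Real.sqrt (outlierFactor (A * H) * outlierFactor (Hᵀ * B))) *
        frob A * frob B := by
  have hH' : H * Hᵀ = 1 := mul_eq_one_comm.mp hH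
  have hAB : A * H * (Hᵀ * B) = A * B := by
    rw [Matrix.mul_assoc, ← Matrix.mul_assoc H, hH', Matrix.one_mul]
  have hfA : frob (A * H) = frob A := frob_mul_of_mul_transpose_eq_one A hH'
  have hfB : frob (Hᵀ * B) = frob B := by
    rw [← frob_transpose, Matrix.transpose_mul, Matrix.transpose_transpose,
      frob_mul_of_mul_transpose_eq_one _ hH', frob_transpose]
  have h := frob_mul_sub_mul_le (A * H) QA (Hᵀ * B) QB (hfA.symm ▸ hQA) (hfB.symm ▸ hQB)
  rw [hAB, hfA, hfB] at h
  rw [Real.sqrt_mul (outlierFactor_nonneg _)]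
  linarith
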